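/- Let M be a tempered weight on ℝ^N × ℝ^N and m a tempered weight on ℝ^N. Suppose A : (ℤ^N × ℤ^N) × (ℤ^N × ℤ^N) → ℂ satisfies: for every n ∈ ℕ there exists C_n > 0 with |A_{(α,β),(γ,δ)}| ≤ C_n · ⟨(α,β)−(γ,δ)⟩^{−n} · M((α+γ)/2, (β+δ)/2) for all α,β,γ,δ ∈ ℤ^N; and suppose c : ℤ^N × ℤ^N → ℂ satisfies: for every n ∈ ℕ there exists C'_n > 0 with |c_{γ,δ}| ≤ C'_n · ⟨γ−δ⟩^{−n} · m((γ+δ)/2) for all γ,δ. Then for all α,β ∈ ℤ^N the series b_{α,β} := Σ_{γ,δ∈ℤ^N} A_{(α,β),(γ,δ)} · c_{γ,δ} converges absolutely, and for every n ∈ ℕ there exists C'' > 0 such that |b_{α,β}| ≤ C'' · ⟨α−β⟩^{−n} · M((α+β)/2, (α+β)/2) · m((α+β)/2) for all α,β ∈ ℤ^N. (This is the discrete estimate behind the statement that the magnetic semi-super Weyl product maps S₀(M) × s₀(m) into s₀(m̃) with m̃(X) = M(X,X)·m(X).) -/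

import Mathlib

open MeasureTheory Filter
open scoped ENNReal

noncomputable section

/-- Japanese bracket `⟨v⟩ = √(1+‖v‖²)` with the Euclidean norm on `ℝ^N`. -/
def jbV {N : ℕ} (v : Fin N → ℝ) : ℝ := Real.sqrt (1 + ∑ i, v i ^ 2)

/-- A tempered weight on `ℝ^N`: a positive function `m` with
`m(u+v) ≤ C·m(u)·⟨v⟩^a` for some `C, a > 0`. -/
def IsTemperedWeight {N : ℕ} (m : (Fin N → ℝ) → ℝ) : Prop :=
  (∀ u, 0 < m u) ∧ ∃ C > 0, ∃ a : ℝ, 0 < a ∧ ∀ u v, m (u + v) ≤ C * m u * jbV v ^ a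

/-- A regular magnetic field on `ℝ^d`: smooth, antisymmetric, closed, with all
derivatives of all components bounded. -/
structure IsRegularMagneticField (d : ℕ) (B : Fin d → Fin d → (Fin d → ℝ) → ℝ) : Prop where
  smooth : ∀ j k, ContDiff ℝ (⊤ : ℕ∞) (B j k)
  antisymm : ∀ j k x, B j k x = - B k j x
  closed : ∀ i j k, ∀ x : Fin d → ℝ,
      fderiv ℝ (B j k) x (Pi.single i 1) + fderiv ℝ (B k i) x (Pi.single j 1)
        + fderiv ℝ (B i j) x (Pi.single k 1) = 0
  derivBounded : ∀ j k, ∀ n : ℕ, ∃ C : ℝ, ∀ x, ‖iteratedFDeriv ℝ n (B j k) x‖ ≤ C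

/-- The transversal-gauge vector potential based at `y`:
`A_k(x;y) = Σ_j ∫₀¹ s·(x_j−y_j)·B_{jk}(y+s(x−y)) ds`. -/
def magA (d : ℕ) (B : Fin d → Fin d → (Fin d → ℝ) → ℝ) (y x : Fin d → ℝ) (k : Fin d) : ℝ :=
  ∑ j, ∫ s in (0:ℝ)..1, s * (x j - y j) * B j k (y + s • (x - y))

/-- The circulation `φ(x,y) = Σ_k ∫₀¹ A_k(y+s(x−y))·(x_k−y_k) ds` of `A = A(·;0)`
along the segment from `y` to `x`. -/
def magPhi (d : ℕ) (B : Fin d → Fin d → (Fin d → ℝ) → ℝ) (x y : Fin d → ℝ) : ℝ :=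
  ∑ k, ∫ s in (0:ℝ)..1, magA d B 0 (y + s • (x - y)) k * (x k - y k)

/-- A window function for the magnetic Gabor frame: smooth, compactly supported in
`(−1,1)^d`, with `Σ_{α∈ℤ^d} 𝔤(x−α)² = 1`. -/
structure IsWindow (d : ℕ) (g : (Fin d → ℝ) → ℝ) : Prop where
  smooth : ContDiff ℝ (⊤ : ℕ∞) g
  compactSupport : HasCompactSupport g
  support_subset : ∀ x : Fin d → ℝ, g x ≠ 0 → ∀ i, |x i| < 1
  partition : ∀ x : Fin d → ℝ, ∑' α : Fin d → ℤ, (g (x - fun i => (α i : ℝ))) ^ 2 = 1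

abbrev Idx (d : ℕ) := (Fin d → ℤ) × (Fin d → ℤ)
abbrev Idx2 (d : ℕ) := Idx d × Idx d
abbrev E1 (d : ℕ) := Fin d → ℝ
abbrev E2 (d : ℕ) := E1 d × E1 d
abbrev E4 (d : ℕ) := E2 d × E2 d

/-- The magnetic Gabor function
`𝒢_α̃(x) = (2π)^{−d/2}·e^{iφ(x,α)}·𝔤(x−α)·e^{iα'·(x−α)}` for `α̃ = (α,α')`. -/
def gabor (d : ℕ) (B : Fin d → Fin d → E1 d → ℝ) (g : E1 d → ℝ) (a : Idx d) (x : E1 d) : ℂ :=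
  (((2 * Real.pi) ^ (-(d : ℝ) / 2) : ℝ) : ℂ) *
    Complex.exp (Complex.I * (magPhi d B x (fun i => (a.1 i : ℝ)) : ℂ)) *
    ((g (x - fun i => (a.1 i : ℝ)) : ℝ) : ℂ) *
    Complex.exp (Complex.I * ((∑ i, (a.2 i : ℝ) * (x i - (a.1 i : ℝ)) : ℝ) : ℂ))

/-- `G_{α̃,β̃}(x,y) = 𝒢_α̃(x)·conj(𝒢_β̃(y))`. -/
def gaborTensor (d : ℕ) (B : Fin d → Fin d → E1 d → ℝ) (g : E1 d → ℝ) (a b : Idx d)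
    (p : E2 d) : ℂ :=
  gabor d B g a p.1 * (starRingEnd ℂ) (gabor d B g b p.2)

/-- `T_{α̃,β̃}(x,y) = conj(𝒢_α̃(x))·𝒢_β̃(y)`. -/
def gaborDual (d : ℕ) (B : Fin d → Fin d → E1 d → ℝ) (g : E1 d → ℝ) (a b : Idx d)
    (p : E2 d) : ℂ :=
  (starRingEnd ℂ) (gabor d B g a p.1) * gabor d B g b p.2

/-- The frame coefficient `c_{α̃,β̃}(F) = ∫ F(x,y)·conj(𝒢_α̃(x))·𝒢_β̃(y) dx dy`. -/
def frameCoef (d : ℕ) (B : Fin d → Fin d → E1 d → ℝ) (g : E1 d → ℝ) (a b : Idx d)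
    (F : E2 d → ℂ) : ℂ :=
  ∫ p : E2 d, F p * (starRingEnd ℂ) (gabor d B g a p.1) * gabor d B g b p.2

/-- `⟨(α̃,β̃)⟩` with `(α̃,β̃)` regarded as a point of `ℝ^{4d}`. -/
def jbIdxPair (d : ℕ) (a b : Idx d) : ℝ :=
  Real.sqrt (1 + (∑ i, ((a.1 i : ℝ)) ^ 2) + (∑ i, ((a.2 i : ℝ)) ^ 2)
    + (∑ i, ((b.1 i : ℝ)) ^ 2) + ∑ i, ((b.2 i : ℝ)) ^ 2)

/-- Euclidean Japanese bracket on `ℝ^{4d} = E4 d`. -/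
def jbE4 (d : ℕ) (v : E4 d) : ℝ :=
  Real.sqrt (1 + (∑ i, v.1.1 i ^ 2) + (∑ i, v.1.2 i ^ 2) + (∑ i, v.2.1 i ^ 2) + ∑ i, v.2.2 i ^ 2)

/-- A tempered weight on `ℝ^{4d}`. -/
def IsTemperedWeightE4 (d : ℕ) (M : E4 d → ℝ) : Prop :=
  (∀ u, 0 < M u) ∧ ∃ C > 0, ∃ a : ℝ, 0 < a ∧ ∀ u v, M (u + v) ≤ C * M u * jbE4 d v ^ a

/-- Euclidean Japanese bracket on `ℝ^N × ℝ^N`. -/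
def jbP {N : ℕ} (v : (Fin N → ℝ) × (Fin N → ℝ)) : ℝ :=
  Real.sqrt (1 + (∑ i, v.1 i ^ 2) + ∑ i, v.2 i ^ 2)

/-- A tempered weight on `ℝ^N × ℝ^N ≅ ℝ^{2N}`. -/
def IsTemperedWeightProd {N : ℕ} (m : (Fin N → ℝ) × (Fin N → ℝ) → ℝ) : Prop :=
  (∀ u, 0 < m u) ∧ ∃ C > 0, ∃ a : ℝ, 0 < a ∧ ∀ u v, m (u + v) ≤ C * m u * jbP v ^ a

/-- `⟨(α̃,β̃) − (γ̃,δ̃)⟩` for pairs of indices in `ℤ^{2d} × ℤ^{2d}`. -/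
def jbDiffIdx2 (d : ℕ) (p q : Idx2 d) : ℝ :=
  Real.sqrt (1 + (∑ i, ((p.1.1 i - q.1.1 i : ℤ) : ℝ) ^ 2) + (∑ i, ((p.1.2 i - q.1.2 i : ℤ) : ℝ) ^ 2)
    + (∑ i, ((p.2.1 i - q.2.1 i : ℤ) : ℝ) ^ 2) + ∑ i, ((p.2.2 i - q.2.2 i : ℤ) : ℝ) ^ 2)

/-- The midpoint `((α̃,β̃)+(γ̃,δ̃))/2 ∈ ℝ^{4d}`. -/
def midIdx2 (d : ℕ) (p q : Idx2 d) : E4 d :=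
  ((fun i => ((p.1.1 i + q.1.1 i : ℤ) : ℝ) / 2, fun i => ((p.1.2 i + q.1.2 i : ℤ) : ℝ) / 2),
   (fun i => ((p.2.1 i + q.2.1 i : ℤ) : ℝ) / 2, fun i => ((p.2.2 i + q.2.2 i : ℤ) : ℝ) / 2))

/-- Membership in the Hörmander class `S₀(M)` on `ℝ^{4d}`: smooth, with all
derivatives dominated by `M`. -/
def InS0 (d : ℕ) (M : E4 d → ℝ) (Φ : E4 d → ℂ) : Prop :=
  ContDiff ℝ (⊤ : ℕ∞) Φ ∧ ∀ n : ℕ, ∃ C : ℝ, ∀ X, ‖iteratedFDeriv ℝ n Φ X‖ ≤ C * M X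

/-- The seminorms `‖Φ‖_{S₀(M),k}`. -/
def s0Seminorm (d : ℕ) (M : E4 d → ℝ) (k : ℕ) (Φ : E4 d → ℂ) : ℝ :=
  ∑ n ∈ Finset.range (k + 1), ⨆ X : E4 d, ‖iteratedFDeriv ℝ n Φ X‖ / M X

/-- The integrand of the inner (oscillatory) integral defining `H_{(α̃,β̃),(γ̃,δ̃)}`,
evaluated at `X = ((v_L,ξ_L),(v_R,ξ_R))` and `z = (z_L,z_R)`. -/
def gaborKernel4 (d : ℕ) (B : Fin d → Fin d → E1 d → ℝ) (g : E1 d → ℝ) (ab gd : Idx2 d)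
    (X : E4 d) (z : E2 d) : ℂ :=
  Complex.exp (Complex.I * (((∑ i, X.1.2 i * z.1 i) - ∑ i, X.2.2 i * z.2 i : ℝ) : ℂ)) *
  Complex.exp (Complex.I * ((magPhi d B (X.1.1 + (2 : ℝ)⁻¹ • z.1) (X.1.1 - (2 : ℝ)⁻¹ • z.1)
      - magPhi d B (X.2.1 + (2 : ℝ)⁻¹ • z.2) (X.2.1 - (2 : ℝ)⁻¹ • z.2) : ℝ) : ℂ)) *
  gabor d B g gd.1 (X.1.1 + (2 : ℝ)⁻¹ • z.1) *
  (starRingEnd ℂ) (gabor d B g gd.2 (X.2.1 + (2 : ℝ)⁻¹ • z.2)) *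
  (starRingEnd ℂ) (gabor d B g ab.1 (X.1.1 - (2 : ℝ)⁻¹ • z.1)) *
  gabor d B g ab.2 (X.2.1 - (2 : ℝ)⁻¹ • z.2)

/-- The kernel `H_{(α̃,β̃),(γ̃,δ̃)}` on `ℝ^{4d}`. -/
def matH (d : ℕ) (B : Fin d → Fin d → E1 d → ℝ) (g : E1 d → ℝ) (ab gd : Idx2 d)
    (X : E4 d) : ℂ :=
  (((2 * Real.pi) ^ (-(2 * (d : ℝ))) : ℝ) : ℂ) * ∫ z : E2 d, gaborKernel4 d B g ab gd X z

/-- The matrix element `𝕄_{(α̃,β̃),(γ̃,δ̃)}[Φ] = ∫ Φ·H_{(α̃,β̃),(γ̃,δ̃)}`. -/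
def matElem (d : ℕ) (B : Fin d → Fin d → E1 d → ℝ) (g : E1 d → ℝ) (Φ : E4 d → ℂ)
    (ab gd : Idx2 d) : ℂ :=
  ∫ X : E4 d, Φ X * matH d B g ab gd X

/-- The dequantized frame symbol
`g_{α̃,γ̃}(v,ξ) = ∫ e^{−iξ·z}·e^{−iφ(v+z/2,v−z/2)}·𝒢_α̃(v+z/2)·conj(𝒢_γ̃(v−z/2)) dz`. -/
def deqSymbol (d : ℕ) (B : Fin d → Fin d → E1 d → ℝ) (g : E1 d → ℝ) (ac : Idx d × Idx d)
    (vξ : E2 d) : ℂ :=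
  ∫ z : E1 d,
    Complex.exp (-Complex.I * ((∑ i, vξ.2 i * z i : ℝ) : ℂ)) *
    Complex.exp (-Complex.I * ((magPhi d B (vξ.1 + (2 : ℝ)⁻¹ • z) (vξ.1 - (2 : ℝ)⁻¹ • z) : ℝ) : ℂ)) *
    gabor d B g ac.1 (vξ.1 + (2 : ℝ)⁻¹ • z) *
    (starRingEnd ℂ) (gabor d B g ac.2 (vξ.1 - (2 : ℝ)⁻¹ • z))

/-- `⟨(α,β)−(γ,δ)⟩` for pairs of lattice points, regarded in `ℝ^{2N}`. -/
def jbPairDiff {N : ℕ} (p q : (Fin N → ℤ) × (Fin N → ℤ)) : ℝ :=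
  Real.sqrt (1 + (∑ i, ((p.1 i - q.1 i : ℤ) : ℝ) ^ 2) + ∑ i, ((p.2 i - q.2 i : ℤ) : ℝ) ^ 2)

/-- The midpoint `(u+v)/2 ∈ ℝ^N` of two lattice points. -/
def midZ {N : ℕ} (u v : Fin N → ℤ) : Fin N → ℝ := fun i => ((u i + v i : ℤ) : ℝ) / 2

lemma one_le_jbV {N : ℕ} (v : Fin N → ℝ) : 1 ≤ jbV v := by
  have : 0 ≤ ∑ i, v i ^ 2 := Finset.sum_nonneg fun i _ => sq_nonneg _
  exact Real.one_le_sqrt.2 (by linarith)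

lemma one_le_jbP {N : ℕ} (v : (Fin N → ℝ) × (Fin N → ℝ)) : 1 ≤ jbP v := by
  have h₁ : 0 ≤ ∑ i, v.1 i ^ 2 := Finset.sum_nonneg fun i _ => sq_nonneg _
  have h₂ : 0 ≤ ∑ i, v.2 i ^ 2 := Finset.sum_nonneg fun i _ => sq_nonneg _
  exact Real.one_le_sqrt.2 (by linarith)

lemma jbPairDiff_sq {N : ℕ} (p q : (Fin N → ℤ) × (Fin N → ℤ)) :
    jbPairDiff p q ^ 2 =
      1 + (∑ i, ((p.1 i - q.1 i : ℤ) : ℝ) ^ 2) + ∑ i, ((p.2 i - q.2 i : ℤ) : ℝ) ^ 2 :=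
  Real.sq_sqrt (by positivity)

lemma one_le_jbPairDiff {N : ℕ} (p q : (Fin N → ℤ) × (Fin N → ℤ)) : 1 ≤ jbPairDiff p q := by
  have h₁ : 0 ≤ ∑ i, ((p.1 i - q.1 i : ℤ) : ℝ) ^ 2 := Finset.sum_nonneg fun i _ => sq_nonneg _
  have h₂ : 0 ≤ ∑ i, ((p.2 i - q.2 i : ℤ) : ℝ) ^ 2 := Finset.sum_nonneg fun i _ => sq_nonneg _
  exact Real.one_le_sqrt.2 (by linarith)

lemma jbV_sq {N : ℕ} (v : Fin N → ℝ) : jbV v ^ 2 = 1 + ∑ i, v i ^ 2 :=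
  Real.sq_sqrt (by positivity)

lemma rpow_le_pow_ceil {x a : ℝ} (hx : 1 ≤ x) : x ^ a ≤ x ^ ⌈a⌉₊ := by
  rw [← Real.rpow_natCast]
  exact Real.rpow_le_rpow_of_exponent_le hx (Nat.le_ceil a)

lemma IsTemperedWeight.exists_pow_bound {N : ℕ} {m : (Fin N → ℝ) → ℝ}
    (hm : IsTemperedWeight m) :
    ∃ C > 0, ∃ k : ℕ, ∀ u v, m (u + v) ≤ C * m u * jbV v ^ k := by
  obtain ⟨hpos, C, hC, a, -, h⟩ := hm
  refine ⟨C, hC, ⌈a⌉₊, fun u v => (h u v).trans ?_⟩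
  have := hpos u
  gcongr
  exact rpow_le_pow_ceil (one_le_jbV v)

lemma IsTemperedWeightProd.exists_pow_bound {N : ℕ} {M : (Fin N → ℝ) × (Fin N → ℝ) → ℝ}
    (hM : IsTemperedWeightProd M) :
    ∃ C > 0, ∃ k : ℕ, ∀ u v, M (u + v) ≤ C * M u * jbP v ^ k := by
  obtain ⟨hpos, C, hC, a, -, h⟩ := hM
  refine ⟨C, hC, ⌈a⌉₊, fun u v => (h u v).trans ?_⟩
  have := hpos u
  gcongr
  exact rpow_le_pow_ceil (one_le_jbP v)

lemma summable_prod_apply {ι κ : Type*} [Fintype ι] {f : κ → ℝ} (hf : Summable f)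
    (hf₀ : ∀ k, 0 ≤ f k) : Summable fun x : ι → κ => ∏ i, f (x i) := by
  classical
  refine summable_of_sum_le (c := ∏ _i : ι, ∑' k, f k)
    (fun x => Finset.prod_nonneg fun i _ => hf₀ _) fun s => ?_
  calc ∑ x ∈ s, ∏ i, f (x i)
      ≤ ∑ x ∈ Fintype.piFinset fun i => s.image fun x => x i, ∏ i, f (x i) := by
        refine Finset.sum_le_sum_of_subset_of_nonneg (fun x hx => ?_)
          fun x _ _ => Finset.prod_nonneg fun i _ => hf₀ _
        exact Fintype.mem_piFinset.2 fun i => Finset.mem_image_of_mem (fun x : ι → κ => x i) hx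
    _ = ∏ i, ∑ k ∈ s.image fun x => x i, f k := (Finset.prod_univ_sum _ _).symm
    _ ≤ ∏ _i : ι, ∑' k, f k :=
        Finset.prod_le_prod (fun i _ => Finset.sum_nonneg fun k _ => hf₀ k)
          fun i _ => hf.sum_le_tsum _ fun k _ => hf₀ k

lemma summable_inv_one_add_int_sq : Summable fun z : ℤ => (1 + (z : ℝ) ^ 2)⁻¹ := by
  have h : Summable fun z : ℤ => 1 / (z : ℝ) ^ 2 + if z = 0 then (1 : ℝ) else 0 :=
    (Real.summable_one_div_int_pow.2 one_lt_two).add (hasSum_ite_eq 0 1).summable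
  refine h.of_nonneg_of_le (fun z => by positivity) fun z => ?_
  rcases eq_or_ne z 0 with rfl | hz
  · simp
  · have : (0 : ℝ) < (z : ℝ) ^ 2 := by positivity
    simp only [hz, if_false, add_zero, one_div]
    gcongr
    linarith

/-- A summable product weight on the lattice `ℤ^N × ℤ^N`. -/
def latticeWeight {N : ℕ} (x : (Fin N → ℤ) × (Fin N → ℤ)) : ℝ :=
  (∏ i, (1 + (x.1 i : ℝ) ^ 2)⁻¹) * ∏ i, (1 + (x.2 i : ℝ) ^ 2)⁻¹

lemma latticeWeight_pos {N : ℕ} (x : (Fin N → ℤ) × (Fin N → ℤ)) : 0 < latticeWeight x :=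
  mul_pos (Finset.prod_pos fun _ _ => by positivity) (Finset.prod_pos fun _ _ => by positivity)

lemma summable_latticeWeight (N : ℕ) :
    Summable (latticeWeight : (Fin N → ℤ) × (Fin N → ℤ) → ℝ) := by
  have h : Summable fun x : Fin N → ℤ => ∏ i, (1 + (x i : ℝ) ^ 2)⁻¹ :=
    summable_prod_apply (f := fun z : ℤ => (1 + (z : ℝ) ^ 2)⁻¹) summable_inv_one_add_int_sq
      fun _ => by positivity
  have h₀ : 0 ≤ fun x : Fin N → ℤ => ∏ i, (1 + (x i : ℝ) ^ 2)⁻¹ :=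
    fun x => Finset.prod_nonneg fun i _ => inv_nonneg.2 (by positivity)
  have hprod := h.mul_of_nonneg h h₀ h₀
  exact hprod

lemma inv_jbPairDiff_pow_le_latticeWeight {N : ℕ} (p q : (Fin N → ℤ) × (Fin N → ℤ)) :
    (jbPairDiff p q ^ (4 * N))⁻¹ ≤ latticeWeight (p - q) := by
  have hS := jbPairDiff_sq p q
  have h₁ (i : Fin N) : 1 + (((p - q).1 i : ℤ) : ℝ) ^ 2 ≤ jbPairDiff p q ^ 2 := by
    have := Finset.single_le_sum (f := fun i => ((p.1 i - q.1 i : ℤ) : ℝ) ^ 2)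
      (fun _ _ => sq_nonneg _) (Finset.mem_univ i)
    have : 0 ≤ ∑ i, ((p.2 i - q.2 i : ℤ) : ℝ) ^ 2 := by positivity
    simp only [Prod.fst_sub, Pi.sub_apply] at *
    linarith
  have h₂ (i : Fin N) : 1 + (((p - q).2 i : ℤ) : ℝ) ^ 2 ≤ jbPairDiff p q ^ 2 := by
    have := Finset.single_le_sum (f := fun i => ((p.2 i - q.2 i : ℤ) : ℝ) ^ 2)
      (fun _ _ => sq_nonneg _) (Finset.mem_univ i)
    have : 0 ≤ ∑ i, ((p.1 i - q.1 i : ℤ) : ℝ) ^ 2 := by positivity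
    simp only [Prod.snd_sub, Pi.sub_apply] at *
    linarith
  have hp₁ := Finset.prod_le_prod (s := Finset.univ) (fun i _ => by positivity) fun i _ => h₁ i
  have hp₂ := Finset.prod_le_prod (s := Finset.univ) (fun i _ => by positivity) fun i _ => h₂ i
  simp only [Finset.prod_const, Finset.card_univ, Fintype.card_fin, ← pow_mul] at hp₁ hp₂
  rw [latticeWeight, Finset.prod_inv_distrib, Finset.prod_inv_distrib, ← mul_inv]
  have h₀ (x : Fin N → ℤ) : 0 < ∏ i, (1 + (x i : ℝ) ^ 2) :=
    Finset.prod_pos fun _ _ => by positivity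
  refine inv_anti₀ (mul_pos (h₀ _) (h₀ _)) ?_
  calc _ ≤ jbPairDiff p q ^ (2 * N) * jbPairDiff p q ^ (2 * N) := by
        exact mul_le_mul hp₁ hp₂ (h₀ _).le (pow_nonneg (by linarith [one_le_jbPairDiff p q]) _)
    _ = jbPairDiff p q ^ (4 * N) := by ring

lemma jbV_sub_le {N : ℕ} (α β γ δ : Fin N → ℤ) :
    jbV (fun i => ((α i - β i : ℤ) : ℝ)) ≤
      2 * (jbPairDiff (α, β) (γ, δ) * jbV fun i => ((γ i - δ i : ℤ) : ℝ)) := by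
  have hS := one_le_jbPairDiff (α, β) (γ, δ)
  have hT := one_le_jbV fun i => ((γ i - δ i : ℤ) : ℝ)
  refine le_of_pow_le_pow_left₀ two_ne_zero (by positivity) ?_
  rw [mul_pow, mul_pow, jbPairDiff_sq, jbV_sq, jbV_sq]
  have h : ∑ i, ((α i - β i : ℤ) : ℝ) ^ 2 ≤ 3 * (∑ i, ((α i - γ i : ℤ) : ℝ) ^ 2 +
      ∑ i, ((β i - δ i : ℤ) : ℝ) ^ 2 + ∑ i, ((γ i - δ i : ℤ) : ℝ) ^ 2) := by
    rw [← Finset.sum_add_distrib, ← Finset.sum_add_distrib, Finset.mul_sum]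
    refine Finset.sum_le_sum fun i _ => ?_
    push_cast
    nlinarith [sq_nonneg ((α i - γ i : ℝ) + (β i - δ i)),
      sq_nonneg ((α i - γ i : ℝ) - (γ i - δ i)), sq_nonneg ((β i - δ i : ℝ) + (γ i - δ i))]
  have hx : 0 ≤ ∑ i, ((α i - γ i : ℤ) : ℝ) ^ 2 := by positivity
  have hy : 0 ≤ ∑ i, ((β i - δ i : ℤ) : ℝ) ^ 2 := by positivity
  have hz : 0 ≤ ∑ i, ((γ i - δ i : ℤ) : ℝ) ^ 2 := by positivity
  nlinarith [mul_nonneg (add_nonneg hx hy) hz]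

lemma jbV_midZ_sub_le {N : ℕ} (α β γ δ : Fin N → ℤ) :
    jbV (midZ γ δ - midZ α β) ≤ jbPairDiff (α, β) (γ, δ) := by
  have hS := one_le_jbPairDiff (α, β) (γ, δ)
  refine le_of_pow_le_pow_left₀ two_ne_zero (by positivity) ?_
  rw [jbPairDiff_sq, jbV_sq, add_assoc, ← Finset.sum_add_distrib]
  gcongr 1 + ∑ i, ?_ with i
  simp only [midZ, Pi.sub_apply]
  push_cast
  nlinarith [sq_nonneg ((α i - γ i : ℝ) - (β i - δ i)), sq_nonneg (α i - γ i : ℝ),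
    sq_nonneg (β i - δ i : ℝ)]

lemma jbP_midZ_sub_le {N : ℕ} (α β γ δ : Fin N → ℤ) :
    jbP ((midZ α γ, midZ β δ) - (midZ α β, midZ α β)) ≤
      jbPairDiff (α, β) (γ, δ) * jbV fun i => ((γ i - δ i : ℤ) : ℝ) := by
  have hS := one_le_jbPairDiff (α, β) (γ, δ)
  have hT := one_le_jbV fun i => ((γ i - δ i : ℤ) : ℝ)
  refine le_of_pow_le_pow_left₀ two_ne_zero (by positivity) ?_
  rw [mul_pow, jbPairDiff_sq, jbV_sq, jbP, Real.sq_sqrt (by positivity)]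
  have h : ∑ i, ((midZ α γ, midZ β δ) - (midZ α β, midZ α β)).1 i ^ 2 +
      ∑ i, ((midZ α γ, midZ β δ) - (midZ α β, midZ α β)).2 i ^ 2 ≤
      ∑ i, ((α i - γ i : ℤ) : ℝ) ^ 2 +
      ∑ i, ((β i - δ i : ℤ) : ℝ) ^ 2 + ∑ i, ((γ i - δ i : ℤ) : ℝ) ^ 2 := by
    simp only [← Finset.sum_add_distrib]
    refine Finset.sum_le_sum fun i _ => ?_
    simp only [midZ, Prod.fst_sub, Prod.snd_sub, Pi.sub_apply]
    push_cast
    nlinarith [sq_nonneg ((γ i - δ i : ℝ) + (β i - δ i)), sq_nonneg ((α i - γ i : ℝ) - (γ i - δ i)),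
      sq_nonneg (α i - γ i : ℝ), sq_nonneg (β i - δ i : ℝ)]
  have hx : 0 ≤ ∑ i, ((α i - γ i : ℤ) : ℝ) ^ 2 := by positivity
  have hy : 0 ≤ ∑ i, ((β i - δ i : ℤ) : ℝ) ^ 2 := by positivity
  have hz : 0 ≤ ∑ i, ((γ i - δ i : ℤ) : ℝ) ^ 2 := by positivity
  nlinarith [mul_nonneg (add_nonneg hx hy) hz]

lemma exists_norm_mul_le_latticeWeight {N : ℕ}
    {M : (Fin N → ℝ) × (Fin N → ℝ) → ℝ} (hM : IsTemperedWeightProd M)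
    {m : (Fin N → ℝ) → ℝ} (hm : IsTemperedWeight m)
    {A : ((Fin N → ℤ) × (Fin N → ℤ)) → ((Fin N → ℤ) × (Fin N → ℤ)) → ℂ}
    (hA : ∀ n : ℕ, ∃ C > 0, ∀ p q : (Fin N → ℤ) × (Fin N → ℤ),
        ‖A p q‖ ≤ C * M (midZ p.1 q.1, midZ p.2 q.2) / jbPairDiff p q ^ n)
    {c : (Fin N → ℤ) → (Fin N → ℤ) → ℂ}
    (hc : ∀ n : ℕ, ∃ C > 0, ∀ γ δ : Fin N → ℤ,
        ‖c γ δ‖ ≤ C * m (midZ γ δ) / jbV (fun i => ((γ i - δ i : ℤ) : ℝ)) ^ n) (n : ℕ) :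
    ∃ C > 0, ∀ (α β : Fin N → ℤ) (q : (Fin N → ℤ) × (Fin N → ℤ)),
      ‖A (α, β) q * c q.1 q.2‖ ≤ C * M (midZ α β, midZ α β) * m (midZ α β)
        / jbV (fun i => ((α i - β i : ℤ) : ℝ)) ^ n * latticeWeight ((α, β) - q) := by
  obtain ⟨CM, hCM, k, hMk⟩ := hM.exists_pow_bound
  obtain ⟨Cm, hCm, l, hml⟩ := hm.exists_pow_bound
  obtain ⟨C₁, hC₁, hA⟩ := hA (n + k + l + 4 * N)
  obtain ⟨C₂, hC₂, hc⟩ := hc (n + k)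
  refine ⟨C₁ * CM * (C₂ * Cm) * 2 ^ n, by positivity, fun α β ⟨γ, δ⟩ => ?_⟩
  have hS := one_le_jbPairDiff (α, β) (γ, δ)
  have hT := one_le_jbV fun i => ((γ i - δ i : ℤ) : ℝ)
  have hR := one_le_jbV fun i => ((α i - β i : ℤ) : ℝ)
  have hRST := jbV_sub_le α β γ δ
  have hU := jbV_midZ_sub_le α β γ δ
  have hV := jbP_midZ_sub_le α β γ δ
  have hW := inv_jbPairDiff_pow_le_latticeWeight (α, β) (γ, δ)
  have hV₁ := one_le_jbP ((midZ α γ, midZ β δ) - (midZ α β, midZ α β))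
  have hU₁ := one_le_jbV (midZ γ δ - midZ α β)
  have hM' := hMk (midZ α β, midZ α β) ((midZ α γ, midZ β δ) - (midZ α β, midZ α β))
  have hm' := hml (midZ α β) (midZ γ δ - midZ α β)
  rw [add_sub_cancel] at hM' hm'
  have hM₀ := hM.1 (midZ α β, midZ α β)
  have hm₀ := hm.1 (midZ α β)
  have hA' := hA (α, β) (γ, δ)
  have hc' := hc γ δ
  dsimp only at hA' hc' ⊢
  generalize jbPairDiff (α, β) (γ, δ) = S at *
  generalize jbV (fun i => ((γ i - δ i : ℤ) : ℝ)) = T at *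
  generalize jbV (fun i => ((α i - β i : ℤ) : ℝ)) = R at *
  generalize jbP _ = V at *
  generalize jbV _ = U at *
  generalize latticeWeight _ = w at *
  generalize M (midZ α β, midZ α β) = M₀ at *
  generalize m (midZ α β) = m₀ at *
  have hA₂ : ‖A (α, β) (γ, δ)‖ ≤ C₁ * (CM * M₀ * (S * T) ^ k) / S ^ (n + k + l + 4 * N) :=
    hA'.trans (by gcongr; exact hM'.trans (by gcongr))
  have hc₂ : ‖c γ δ‖ ≤ C₂ * (Cm * m₀ * S ^ l) / T ^ (n + k) :=
    hc'.trans (by gcongr; exact hm'.trans (by gcongr))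
  have hinv : ((S * T) ^ n)⁻¹ ≤ 2 ^ n / R ^ n := by
    rw [← one_div, div_le_div_iff₀ (by positivity) (by positivity), one_mul, ← mul_pow]
    gcongr
  calc ‖A (α, β) (γ, δ) * c γ δ‖
      ≤ (C₁ * (CM * M₀ * (S * T) ^ k) / S ^ (n + k + l + 4 * N)) *
          (C₂ * (Cm * m₀ * S ^ l) / T ^ (n + k)) := by
        rw [norm_mul]
        gcongr
    _ = C₁ * CM * (C₂ * Cm) * M₀ * m₀ * ((S * T) ^ n)⁻¹ * (S ^ (4 * N))⁻¹ := by
        simp only [pow_add, mul_pow]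
        field_simp
    _ ≤ C₁ * CM * (C₂ * Cm) * M₀ * m₀ * (2 ^ n / R ^ n) * w := by gcongr
    _ = C₁ * CM * (C₂ * Cm) * 2 ^ n * M₀ * m₀ / R ^ n * w := by ring

/-- the discrete estimate behind the semi-super Weyl product
`S₀(M) •ᴮ s₀(m) ⊆ s₀(m̃)` with `m̃(X) = M(X,X)·m(X)`. -/
theorem statement19 (N : ℕ) (hN : 0 < N)
    (M : (Fin N → ℝ) × (Fin N → ℝ) → ℝ) (hM : IsTemperedWeightProd M)
    (m : (Fin N → ℝ) → ℝ) (hm : IsTemperedWeight m)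
    (A : ((Fin N → ℤ) × (Fin N → ℤ)) → ((Fin N → ℤ) × (Fin N → ℤ)) → ℂ)
    (hA : ∀ n : ℕ, ∃ C > 0, ∀ p q : (Fin N → ℤ) × (Fin N → ℤ),
        ‖A p q‖ ≤ C * M (midZ p.1 q.1, midZ p.2 q.2) / jbPairDiff p q ^ n)
    (c : (Fin N → ℤ) → (Fin N → ℤ) → ℂ)
    (hc : ∀ n : ℕ, ∃ C > 0, ∀ γ δ : Fin N → ℤ,
        ‖c γ δ‖ ≤ C * m (midZ γ δ) / jbV (fun i => ((γ i - δ i : ℤ) : ℝ)) ^ n) :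
    (∀ α β : Fin N → ℤ, Summable fun q : (Fin N → ℤ) × (Fin N → ℤ) =>
        ‖A (α, β) q * c q.1 q.2‖) ∧
    (∀ n : ℕ, ∃ C > 0, ∀ α β : Fin N → ℤ,
        ‖∑' q : (Fin N → ℤ) × (Fin N → ℤ), A (α, β) q * c q.1 q.2‖ ≤
          C * M (midZ α β, midZ α β) * m (midZ α β)
            / jbV (fun i => ((α i - β i : ℤ) : ℝ)) ^ n) := by
  have hsum (p : (Fin N → ℤ) × (Fin N → ℤ)) : Summable fun q => latticeWeight (p - q) :=
    (summable_latticeWeight N).comp_injective (i := fun q => p - q) sub_right_injective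
  refine ⟨fun α β => ?_, fun n => ?_⟩
  · obtain ⟨C, -, h⟩ := exists_norm_mul_le_latticeWeight hM hm hA hc 0
    exact ((hsum (α, β)).mul_left _).of_nonneg_of_le (fun q => norm_nonneg _) (h α β)
  · obtain ⟨C, hC, h⟩ := exists_norm_mul_le_latticeWeight hM hm hA hc n
    have hW : 0 < ∑' x : (Fin N → ℤ) × (Fin N → ℤ), latticeWeight x :=
      (summable_latticeWeight N).tsum_pos (fun x => (latticeWeight_pos x).le) 0
        (latticeWeight_pos 0)
    refine ⟨C * ∑' x : (Fin N → ℤ) × (Fin N → ℤ), latticeWeight x, by positivity,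
      fun α β => ?_⟩
    refine (tsum_of_norm_bounded ((hsum (α, β)).mul_left _).hasSum (h α β)).trans_eq ?_
    have heq : ∑' q, latticeWeight ((α, β) - q) =
        ∑' x : (Fin N → ℤ) × (Fin N → ℤ), latticeWeight x :=
      (Equiv.subLeft (α, β)).tsum_eq latticeWeight
    rw [tsum_mul_left, heq]
    ring
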